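/- Let R = F[[X,Y,Z]]/(X^N+Y^N+Z^N), N ≥ 3, char F = p with p ∤ N, F infinite, I = (y,z), m = (x,y,z). Then the tight reduction number of I equals N-2; that is, (I^k)^* = I (I^{k-1})^* for all k ≥ N-1, but (I^{N-2})^* ≠ I (I^{N-3})^*. -/

import Mathlib

/-- The Frobenius power `I^[q]` of an ideal: the ideal generated by `q`-th powers of
elements of `I`. -/
def Ideal.frobeniusPower {R : Type*} [CommRing R] (I : Ideal R) (q : ℕ) : Ideal R :=
  Ideal.span ((· ^ q) '' (I : Set R))

/-- `x` belongs to the tight closure of `I` (in characteristic `p`): there is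
`c ∈ R°` (not in any minimal prime) with `c * x^q ∈ I^[q]` for all large `q = p^e`. -/
def Ideal.memTightClosure {R : Type*} [CommRing R] (p : ℕ) (I : Ideal R) (x : R) : Prop :=
  ∃ c : R, (∀ P ∈ minimalPrimes R, c ∉ P) ∧
    ∃ N : ℕ, ∀ e : ℕ, N ≤ e → c * x ^ p ^ e ∈ I.frobeniusPower (p ^ e)

/-- The tight closure `I^*` of an ideal `I`. -/
def Ideal.tightClosure {R : Type*} [CommRing R] (p : ℕ) (I : Ideal R) : Ideal R :=
  Ideal.span {x : R | I.memTightClosure p x}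


set_option synthInstance.maxHeartbeats 1000000

open MvPowerSeries

namespace Polynomial
variable {L : Type*} [Field L]

lemma mod_le_of_coeff_expand_mul_ne_zero {q γ : ℕ} (hγ : γ < q) (g h : L[X])
    (hh : h.natDegree ≤ γ) {n : ℕ} (hn : (expand L q g * h).coeff n ≠ 0) : n % q ≤ γ := by
  rw [coeff_mul] at hn
  obtain ⟨⟨i, j⟩, hij, hne⟩ := Finset.exists_ne_zero_of_sum_ne_zero hn
  rw [Finset.HasAntidiagonal.mem_antidiagonal] at hij
  have h1 := left_ne_zero_of_mul hne
  have h2 := le_natDegree_of_ne_zero (right_ne_zero_of_mul hne)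
  rw [coeff_expand (by omega)] at h1
  have hd : q ∣ i := by
    by_contra hd
    simp [hd] at h1
  obtain ⟨t, rfl⟩ := hd
  simp only at hij h2
  rw [← hij, Nat.mul_add_mod, Nat.mod_eq_of_lt (by omega)]
  omega

lemma mod_le_of_coeff_taylor_ne_zero {p : ℕ} [Fact p.Prime] [CharP L p] {e γ : ℕ}
    (hγ : γ < p ^ e) {P : L[X]} (hP : ∀ n, P.coeff n ≠ 0 → n % p ^ e ≤ γ) (ζ : L) {n : ℕ}
    (hn : (taylor ζ P).coeff n ≠ 0) : n % p ^ e ≤ γ := by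
  rw [P.as_sum_support, map_sum, finsetSum_coeff] at hn
  obtain ⟨m, hm, hne⟩ := Finset.exists_ne_zero_of_sum_ne_zero hn
  have hm' := hP m (mem_support_iff.mp hm)
  rw [taylor_monomial, coeff_C_mul] at hne
  refine mod_le_of_coeff_expand_mul_ne_zero hγ ((X + C (ζ ^ p ^ e)) ^ (m / p ^ e))
    ((X + C ζ) ^ (m % p ^ e)) ?_ (n := n) ?_
  · rw [natDegree_pow, natDegree_X_add_C, mul_one]
    exact hm'
  · have h : (X + C ζ) ^ m = expand L (p ^ e) ((X + C (ζ ^ p ^ e)) ^ (m / p ^ e)) *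
        (X + C ζ) ^ (m % p ^ e) := by
      conv_lhs => rw [← Nat.div_add_mod m (p ^ e), pow_add, pow_mul, add_pow_char_pow]
      simp
    rw [← h]
    exact right_ne_zero_of_mul hne

lemma rootMultiplicity_mod_le {p : ℕ} [Fact p.Prime] [CharP L p] {e γ : ℕ}
    (hγ : γ < p ^ e) {P : L[X]} (hP0 : P ≠ 0) (hP : ∀ n, P.coeff n ≠ 0 → n % p ^ e ≤ γ)
    (ζ : L) : P.rootMultiplicity ζ % p ^ e ≤ γ := by
  rw [rootMultiplicity_eq_natTrailingDegree]
  refine mod_le_of_coeff_taylor_ne_zero hγ hP ζ ?_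
  rw [← taylor_apply]
  exact trailingCoeff_nonzero_iff_nonzero.mpr (by simpa using hP0)

lemma exists_coeff_mul_fermat_pow_ne_zero {p : ℕ} [Fact p.Prime] [CharP L p] {N e γ u : ℕ}
    (hN : N ≠ 0) (hpN : ¬ p ∣ N) (hu : γ < u) (huq : u + γ < p ^ e) {c a : L[X]} (hc : c ≠ 0)
    (ha : a ≠ 0) (hcγ : c.natDegree ≤ γ) :
    ∃ n, (c * (X ^ N + 1) ^ u * a ^ p ^ e).coeff n ≠ 0 ∧ γ < n % p ^ e := by
  classical
  by_contra! H
  set K := AlgebraicClosure L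
  have hKc : CharP K p := charP_of_injective_algebraMap (algebraMap L K).injective p
  let f := algebraMap L K
  have hN' : (N : K) ≠ 0 := by rwa [Ne, CharP.cast_eq_zero_iff K p]
  obtain ⟨ζ, hζ⟩ := IsAlgClosed.exists_pow_nat_eq (-1 : K) (Nat.pos_of_ne_zero hN)
  have hζ0 : ζ ≠ 0 := by
    rintro rfl
    simp [hN] at hζ
  have hG0 : (X ^ N + 1 : K[X]) ≠ 0 := X_pow_add_C_ne_zero (Nat.pos_of_ne_zero hN) 1
  have hG : (X ^ N + 1 : K[X]).rootMultiplicity ζ = 1 := by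
    refine le_antisymm ?_ ?_
    · by_contra! h
      have := (one_lt_rootMultiplicity_iff_isRoot hG0).mp h
      have := this.2
      simp [derivative_X_pow, hN', hζ0] at this
    · rw [Nat.succ_le_iff, rootMultiplicity_pos hG0]
      simp [hζ]
  have hc' : c.map f ≠ 0 := (Polynomial.map_ne_zero_iff f.injective).mpr hc
  have ha' : a.map f ≠ 0 := (Polynomial.map_ne_zero_iff f.injective).mpr ha
  have hP0 : c.map f * (X ^ N + 1) ^ u * (a.map f) ^ p ^ e ≠ 0 :=
    mul_ne_zero (mul_ne_zero hc' (pow_ne_zero _ hG0)) (pow_ne_zero _ ha')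
  have key := rootMultiplicity_mod_le (p := p) (e := e) (γ := γ) (by omega) hP0 (fun n hn => ?_) ζ
  · have h1 : rootMultiplicity ζ (c.map f) ≤ γ := by
      refine le_trans ?_ hcγ
      rw [← natDegree_map f, ← count_roots]
      exact (Multiset.count_le_card _ _).trans (card_roots' _)
    rw [rootMultiplicity_mul hP0, rootMultiplicity_mul (left_ne_zero_of_mul hP0),
      ← count_roots ((X ^ N + 1) ^ u), ← count_roots (map f a ^ _), roots_pow, roots_pow,
      Multiset.count_nsmul, Multiset.count_nsmul, count_roots, count_roots, hG,
      Nat.add_mul_mod_self_left, Nat.mod_eq_of_lt (by omega)] at key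
    omega
  · refine H n fun h => hn ?_
    have : c.map f * (X ^ N + 1) ^ u * (a.map f) ^ p ^ e
      = (c * (X ^ N + 1) ^ u * a ^ p ^ e).map f := by simp
    rw [this, coeff_map, h, map_zero]

end Polynomial

namespace MvPowerSeries
variable {F : Type*} [Field F]

lemma hasSubst_dehomogenize : HasSubst (S := Polynomial F) (τ := Unit)
    ![PowerSeries.C Polynomial.X * PowerSeries.X, PowerSeries.X] := by
  refine hasSubst_of_constantCoeff_zero fun i => ?_
  change PowerSeries.constantCoeff _ = 0
  fin_cases i <;> simp

variable (F) in
/-- The ring homomorphism `F⟦Y, Z⟧ → F[t]⟦s⟧` with `Y ↦ t s` and `Z ↦ s`. -/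
noncomputable def dehomogenize : MvPowerSeries (Fin 2) F →ₐ[F] PowerSeries (Polynomial F) :=
  substAlgHom hasSubst_dehomogenize

lemma dehomogenize_X_zero :
    dehomogenize F (X 0) = PowerSeries.C Polynomial.X * PowerSeries.X := by
  exact (substAlgHom_X hasSubst_dehomogenize _).trans (by simp)

lemma dehomogenize_X_one : dehomogenize F (X 1) = PowerSeries.X := by
  exact (substAlgHom_X hasSubst_dehomogenize _).trans (by simp)

lemma coeff_coeff_dehomogenize (a : MvPowerSeries (Fin 2) F) (n j : ℕ) :
    (PowerSeries.coeff n (dehomogenize F a)).coeff j =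
      if j ≤ n then coeff (Finsupp.single 0 j + Finsupp.single 1 (n - j)) a else 0 := by
  have h (d : Fin 2 →₀ ℕ) : coeff (Finsupp.single () n) (d.prod fun s e =>
      (![PowerSeries.C Polynomial.X * PowerSeries.X, PowerSeries.X] :
        Fin 2 → MvPowerSeries Unit (Polynomial F)) s ^ e) =
      if n = d 0 + d 1 then Polynomial.X ^ d 0 else 0 := by
    rw [Finsupp.prod_fintype _ _ (by simp), Fin.prod_univ_two]
    change PowerSeries.coeff n ((PowerSeries.C Polynomial.X * PowerSeries.X) ^ d 0
      * PowerSeries.X ^ d 1) = _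
    rw [mul_pow, ← map_pow, mul_assoc, ← pow_add, PowerSeries.coeff_C_mul, PowerSeries.coeff_X_pow]
    simp
  have := coeff_subst (hasSubst_dehomogenize (F := F)) a (Finsupp.single () n)
  simp only [h] at this
  rw [dehomogenize, coe_substAlgHom]
  change Polynomial.coeff (coeff (Finsupp.single () n) (subst (S := Polynomial F) _ a)) j = _
  rw [this]
  have hsupp : Function.support (fun d : Fin 2 →₀ ℕ => coeff d a • (if n = d 0 + d 1 then
      (Polynomial.X ^ d 0 : Polynomial F) else 0)) ⊆ ((Finset.range (n + 1)).image fun i =>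
        (Finsupp.single 0 i + Finsupp.single 1 (n - i) : Fin 2 →₀ ℕ)) := by
    intro d hd
    have hd' : n = d 0 + d 1 := by
      by_contra hne
      simp [hne] at hd
    simp only [Finset.coe_image, Set.mem_image, Finset.mem_coe, Finset.mem_range]
    refine ⟨d 0, by omega, ?_⟩
    ext i
    fin_cases i <;> simp [hd']
  rw [finsum_eq_sum_of_support_subset _ hsupp, Finset.sum_image]
  · rw [Polynomial.finsetSum_coeff]
    have : ∀ i ∈ Finset.range (n + 1), (coeff (Finsupp.single 0 i + Finsupp.single 1 (n - i)) a •
        (if n = (Finsupp.single 0 i + Finsupp.single 1 (n - i) : Fin 2 →₀ ℕ) 0 +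
          (Finsupp.single 0 i + Finsupp.single 1 (n - i) : Fin 2 →₀ ℕ) 1 then
          (Polynomial.X ^ (Finsupp.single 0 i + Finsupp.single 1 (n - i) : Fin 2 →₀ ℕ) 0 :
            Polynomial F) else 0)).coeff j =
        if j = i then coeff (Finsupp.single 0 i + Finsupp.single 1 (n - i)) a else 0 := by
      intro i hi
      have : n = i + (n - i) := by
        have := Finset.mem_range.mp hi
        omega
      simp [← this, Polynomial.coeff_X_pow]
    rw [Finset.sum_congr rfl this]
    simp [Finset.sum_ite_eq]
  · intro i _ k _ hik
    simpa using DFunLike.congr_fun hik 0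

lemma dehomogenize_injective : Function.Injective (dehomogenize F) := by
  rw [injective_iff_map_eq_zero]
  intro a ha
  ext d
  have := coeff_coeff_dehomogenize a (d 0 + d 1) (d 0)
  rw [ha, if_pos (by omega)] at this
  have hd : Finsupp.single 0 (d 0) + Finsupp.single 1 (d 0 + d 1 - d 0) = d := by
    ext i
    fin_cases i <;> simp
  rw [hd] at this
  simpa using this.symm

lemma natDegree_coeff_dehomogenize_le (a : MvPowerSeries (Fin 2) F) (n : ℕ) :
    (PowerSeries.coeff n (dehomogenize F a)).natDegree ≤ n := by
  rw [Polynomial.natDegree_le_iff_coeff_eq_zero]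
  intro j hj
  rw [coeff_coeff_dehomogenize, if_neg (by omega)]

lemma mem_span_X_pow_of_coeff_eq_zero {k : ℕ} {a : MvPowerSeries (Fin 2) F}
    (ha : ∀ d : Fin 2 →₀ ℕ, d 0 + d 1 < k → coeff d a = 0) :
    a ∈ Ideal.span {X 0, X 1} ^ k := by
  induction k generalizing a with
  | zero => simp
  | succ k ih =>
    let b : MvPowerSeries (Fin 2) F := fun d => if d 0 = 0 then coeff d a else 0
    have hb (d) : coeff d b = if d 0 = 0 then coeff d a else 0 := rfl
    obtain ⟨b', hb'⟩ : X 1 ∣ b := by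
      rw [X_dvd_iff]
      intro d hd
      rw [hb]
      split_ifs with h
      · exact ha d (by omega)
      · rfl
    obtain ⟨a', ha'⟩ : X 0 ∣ a - b := by
      rw [X_dvd_iff]
      intro d hd
      simp [hb, hd]
    have h0 (d) : coeff d a' = coeff (d + Finsupp.single 0 1) (a - b) := by
      rw [ha', X_def, add_comm, coeff_add_monomial_mul, one_mul]
    have h1 (d) : coeff d b' = coeff (d + Finsupp.single 1 1) b := by
      rw [hb', X_def, add_comm, coeff_add_monomial_mul, one_mul]
    have hab : a = X 0 * a' + X 1 * b' := by rw [← ha', ← hb']; ring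
    rw [hab, pow_succ']
    refine add_mem (Ideal.mul_mem_mul (Ideal.subset_span (by simp)) (ih fun d hd => ?_))
      (Ideal.mul_mem_mul (Ideal.subset_span (by simp)) (ih fun d hd => ?_))
    · rw [h0, map_sub, hb, ha, if_neg (by simp), sub_zero]
      simp
      omega
    · rw [h1, hb, ha, ite_self]
      simp
      omega

lemma le_of_mem_span_X_pow_pow {q k : ℕ} {b : MvPowerSeries (Fin 2) F}
    (hb : b ∈ Ideal.span {X 0 ^ q, X 1 ^ q} ^ k) {n j : ℕ}
    (h : (PowerSeries.coeff n (dehomogenize F b)).coeff j ≠ 0) :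
    k * q ≤ n ∧ (n < k * q + q → j % q ≤ n - k * q) := by
  induction k generalizing b n j with
  | zero =>
    rw [coeff_coeff_dehomogenize] at h
    have hj : j ≤ n := by
      by_contra hj
      simp [hj] at h
    have := Nat.mod_le j q
    exact ⟨by simp, fun _ => by omega⟩
  | succ k ih =>
    have hJ : (Ideal.span {X 0 ^ q, X 1 ^ q} : Ideal (MvPowerSeries (Fin 2) F)) =
        Ideal.span {X 0 ^ q} ⊔ Ideal.span {X 1 ^ q} := Ideal.span_insert _ _
    rw [pow_succ'] at hb
    nth_rw 1 [hJ] at hb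
    rw [Ideal.sup_mul, Submodule.mem_sup] at hb
    obtain ⟨_, h0, _, h1, rfl⟩ := hb
    rw [Ideal.mem_span_singleton_mul] at h0 h1
    obtain ⟨a, ha, rfl⟩ := h0
    obtain ⟨b, hb, rfl⟩ := h1
    have e : dehomogenize F (X 0 ^ q * a + X 1 ^ q * b) =
        PowerSeries.X ^ q * (PowerSeries.C (Polynomial.X ^ q) * dehomogenize F a
          + dehomogenize F b) := by
      simp only [map_add, map_mul, map_pow, dehomogenize_X_zero, dehomogenize_X_one]
      ring
    rw [e, PowerSeries.coeff_X_pow_mul'] at h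
    have hqn : q ≤ n := by
      by_contra hqn
      simp [hqn] at h
    rw [if_pos hqn, map_add, PowerSeries.coeff_C_mul, Polynomial.coeff_add,
      Polynomial.coeff_X_pow_mul'] at h
    rw [add_mul, one_mul]
    have : (q ≤ j ∧ (PowerSeries.coeff (n - q) (dehomogenize F a)).coeff (j - q) ≠ 0) ∨
        (PowerSeries.coeff (n - q) (dehomogenize F b)).coeff j ≠ 0 := by
      by_contra! H
      refine h ?_
      rw [H.2, add_zero]
      split_ifs with hj
      · exact H.1 hj
      · rfl
    rcases this with ⟨hj, h⟩ | h
    · obtain ⟨h1, h2⟩ := ih ha h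
      rw [← Nat.mod_eq_sub_mod hj] at h2
      exact ⟨by omega, fun _ => by have := h2 (by omega); omega⟩
    · obtain ⟨h1, h2⟩ := ih hb h
      exact ⟨by omega, fun _ => by have := h2 (by omega); omega⟩

end MvPowerSeries

lemma PowerSeries.exists_eq_X_pow_mul {S : Type*} [CommRing S] {g : PowerSeries S} (hg : g ≠ 0) :
    ∃ n h, g = X ^ n * h ∧ constantCoeff h ≠ 0 ∧ coeff n g = constantCoeff h := by
  obtain ⟨h, hh⟩ := X_pow_order_dvd (φ := g)
  have h1 : coeff g.order.toNat g = constantCoeff h := by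
    generalize g.order.toNat = n at hh
    rw [hh, coeff_X_pow_mul', if_pos le_rfl, Nat.sub_self, coeff_zero_eq_constantCoeff_apply]
  exact ⟨_, h, hh, h1 ▸ coeff_order hg, h1⟩

namespace MvPowerSeries
variable {F : Type*} [Field F]

lemma mem_span_X_pow_of_forall_mul_fermat_pow_mem {p : ℕ} [Fact p.Prime] [CharP F p]
    {N i k e₀ : ℕ} (hpN : ¬ p ∣ N) (hi : i < N) {c a : MvPowerSeries (Fin 2) F}
    (hc : c ≠ 0) (H : ∀ e, e₀ ≤ e → c * (X 0 ^ N + X 1 ^ N) ^ (i * p ^ e / N) * a ^ p ^ e ∈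
      Ideal.span {X 0 ^ p ^ e, X 1 ^ p ^ e} ^ k) :
    a ∈ Ideal.span {X 0, X 1} ^ (if i = 0 then k else k + 1 - i) := by
  refine mem_span_X_pow_of_coeff_eq_zero fun d hd => ?_
  by_contra had
  have ha : a ≠ 0 := by
    rintro rfl
    simp at had
  obtain ⟨γ, c', hc', hc0, hcγ⟩ := PowerSeries.exists_eq_X_pow_mul
    ((map_ne_zero_iff _ dehomogenize_injective).mpr hc)
  obtain ⟨D, a', ha', ha0, -⟩ := PowerSeries.exists_eq_X_pow_mul
    ((map_ne_zero_iff _ dehomogenize_injective).mpr ha)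
  have hDd : D ≤ d 0 + d 1 := by
    by_contra! hD
    refine had ?_
    have := coeff_coeff_dehomogenize a (d 0 + d 1) (d 0)
    rw [ha', PowerSeries.coeff_X_pow_mul', if_neg (by omega), if_pos (by omega)] at this
    have hd : Finsupp.single 0 (d 0) + Finsupp.single 1 (d 0 + d 1 - d 0) = d := by
      ext i
      fin_cases i <;> simp
    rw [hd] at this
    simpa using this.symm
  have hp1 : 1 < p := (Fact.out : p.Prime).one_lt
  set e := e₀ + N * (γ + 1) with he
  have hq : e < p ^ e := Nat.lt_pow_self hp1
  set q := p ^ e with hqdef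
  set u := i * q / N with hu
  have hNu : N * u ≤ i * q := Nat.mul_div_le _ _
  have hNu' : i * q < N * u + N := Nat.lt_mul_div_succ _ (by omega)
  have hNγ : N * (γ + 1) < q := by omega
  have hmem : c * (X 0 ^ N + X 1 ^ N) ^ u * a ^ q ∈ Ideal.span {X 0 ^ q, X 1 ^ q} ^ k :=
    H e (by omega)
  have key (j : ℕ) (hj : (PowerSeries.constantCoeff c' * (Polynomial.X ^ N + 1) ^ u *
      PowerSeries.constantCoeff a' ^ q).coeff j ≠ 0) := by
    refine le_of_mem_span_X_pow_pow hmem (n := γ + N * u + q * D) (j := j) ?_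
    have e1 : dehomogenize F (c * (X 0 ^ N + X 1 ^ N) ^ u * a ^ q) =
        PowerSeries.X ^ (γ + N * u + q * D) *
          (c' * (PowerSeries.C (Polynomial.X ^ N + 1)) ^ u * a' ^ q) := by
      have hG : dehomogenize F (X 0 ^ N + X 1 ^ N) =
          PowerSeries.X ^ N * PowerSeries.C (Polynomial.X ^ N + 1) := by
        simp only [map_add, map_pow, dehomogenize_X_zero, dehomogenize_X_one, map_one]
        ring
      rw [map_mul, map_mul, map_pow, map_pow, hG, hc', ha']
      ring
    rw [e1, PowerSeries.coeff_X_pow_mul', if_pos le_rfl, Nat.sub_self,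
      PowerSeries.coeff_zero_eq_constantCoeff_apply]
    simpa using hj
  have hdeg : (PowerSeries.constantCoeff c').natDegree ≤ γ := by
    rw [← hcγ]
    exact natDegree_coeff_dehomogenize_le c γ
  rcases Nat.eq_zero_or_pos i with rfl | hi0
  · rw [if_pos rfl] at hd
    have hu0 : u = 0 := by simp [hu]
    have hne : PowerSeries.constantCoeff c' * (Polynomial.X ^ N + 1) ^ u *
      PowerSeries.constantCoeff a' ^ q ≠ 0 := by
      rw [hu0, pow_zero, mul_one]
      exact mul_ne_zero hc0 (pow_ne_zero _ ha0)
    obtain ⟨j, hj⟩ : ∃ j, (PowerSeries.constantCoeff c' * (Polynomial.X ^ N + 1) ^ u *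
      PowerSeries.constantCoeff a' ^ q).coeff j ≠ 0 := by
      by_contra! h
      exact hne (Polynomial.ext h)
    have := (key j hj).1
    rw [hu0] at this
    nlinarith
  · rw [if_neg hi0.ne'] at hd
    obtain ⟨j, hj, hjγ⟩ := Polynomial.exists_coeff_mul_fermat_pow_ne_zero (p := p) (e := e)
      (N := N) (γ := γ) (u := u) (by omega) hpN (by nlinarith) (by nlinarith) hc0 ha0 hdeg
    obtain ⟨h1, h2⟩ := key j hj
    rw [← hqdef] at hjγ
    have hD : q * D + i * q ≤ k * q := by
      have : D + i ≤ k := by omega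
      nlinarith
    have := h2 (by nlinarith)
    omega

end MvPowerSeries

lemma exists_ne_zero_dvd_algebraMap {A R : Type*} [CommRing A] [IsDomain A] [CommRing R]
    [Algebra A R] [Algebra.IsIntegral A R] {c : R} (hc : ∀ P ∈ minimalPrimes R, c ∉ P) :
    ∃ a : A, a ≠ 0 ∧ c ∣ algebraMap A R a := by
  obtain ⟨P, hP, hPc⟩ := Algebra.IsIntegral.isIntegral (R := A) c
  obtain ⟨P', hPP', hP'⟩ :=
    Polynomial.exists_eq_pow_rootMultiplicity_mul_and_not_dvd P hP.ne_zero 0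
  rw [Polynomial.C_0, sub_zero] at hPP' hP'
  rw [Polynomial.X_dvd_iff] at hP'
  rw [← Polynomial.aeval_def, hPP', map_mul, map_pow, Polynomial.aeval_X] at hPc
  have hnil : IsNilpotent (Polynomial.aeval c P') := by
    rw [← mem_nilradical, nilradical, ← Ideal.sInf_minimalPrimes, Ideal.mem_sInf]
    intro J hJ
    have hJp : J.IsPrime := hJ.1.1
    have := hJp.mem_or_mem (hPc ▸ J.zero_mem)
    exact this.resolve_left fun h => hc J hJ (hJp.mem_of_pow_mem _ h)
  obtain ⟨n, hn⟩ := hnil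
  refine ⟨P'.coeff 0 ^ n, pow_ne_zero _ hP', ?_⟩
  have h : c ∣ Polynomial.aeval c P' - algebraMap A R (P'.coeff 0) := by
    conv_rhs => rw [← Polynomial.divX_mul_X_add P']
    simp
  have := h.trans (sub_dvd_pow_sub_pow _ _ n)
  rwa [hn, zero_sub, dvd_neg, ← map_pow] at this

lemma Module.Basis.repr_mem_of_mem_map {ι A R : Type*} [CommRing A] [CommRing R] [Algebra A R]
    (b : Basis ι A R) {J : Ideal A} {r : R} (hr : r ∈ J.map (algebraMap A R)) (i : ι) :
    b.repr r i ∈ J := by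
  have hr' : r ∈ (J • ⊤ : Submodule A R) := by
    rw [Ideal.smul_top_eq_map]
    exact hr
  refine Submodule.smul_induction_on hr' (fun a ha s _ => ?_) fun s t hs ht => ?_
  · rw [map_smul, Finsupp.smul_apply, smul_eq_mul]
    exact J.mul_mem_right _ ha
  · rw [map_add, Finsupp.add_apply]
    exact add_mem hs ht

lemma Module.Basis.algebraMap_mem_nonZeroDivisors {ι A R : Type*} [CommRing A] [CommRing R]
    [Algebra A R] (b : Basis ι A R) {a : A} (ha : a ∈ nonZeroDivisors A) :
    algebraMap A R a ∈ nonZeroDivisors R := by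
  rw [mem_nonZeroDivisors_iff_right]
  intro r hr
  rw [mul_comm, ← Algebra.smul_def] at hr
  rw [← b.repr.map_eq_zero_iff]
  ext i
  have := congrArg (b.repr · i) hr
  rw [map_smul, map_zero, Finsupp.smul_apply, smul_eq_mul, mul_comm] at this
  exact (mem_nonZeroDivisors_iff_right.mp ha) _ this

namespace Ideal

lemma frobeniusPower_prime_pow {R : Type*} [CommRing R] {p : ℕ} [Fact p.Prime] [CharP R p]
    (I : Ideal R) (e : ℕ) : I.frobeniusPower (p ^ e) = I.map (iterateFrobenius R p e) := rfl

lemma frobeniusPower_span_pair_pow {R : Type*} [CommRing R] {p : ℕ} [Fact p.Prime] [CharP R p]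
    (y z : R) (k e : ℕ) :
    (span {y, z} ^ k).frobeniusPower (p ^ e) = span {y ^ p ^ e, z ^ p ^ e} ^ k := by
  rw [frobeniusPower_prime_pow, Ideal.map_pow, Ideal.map_span, Set.image_pair]
  rfl

lemma map_span_pair_pow {A R : Type*} [CommRing A] [CommRing R] (f : A →+* R) (y z : A) (k : ℕ) :
    (span {y, z} ^ k).map f = span {f y, f z} ^ k := by
  rw [Ideal.map_pow, Ideal.map_span, Set.image_pair]

lemma span_pair_pow_le_mul {R : Type*} [CommRing R] (y z : R) (q n : ℕ) :
    span {y, z} ^ (q + q + n) ≤ span {y ^ q, z ^ q} * span {y, z} ^ (q + n) := by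
  have hy : span {y} ≤ span {y, z} := span_mono (by simp)
  have hz : span {z} ≤ span {y, z} := span_mono (by simp)
  have hyq : span {y} ^ q ≤ span {y ^ q, z ^ q} := by
    rw [span_singleton_pow]
    exact span_mono (by simp)
  have hzq : span {z} ^ q ≤ span {y ^ q, z ^ q} := by
    rw [span_singleton_pow]
    exact span_mono (by simp)
  have h : (span {y, z} : Ideal R) = span {y} + span {z} := span_insert _ _
  conv_lhs => rw [h, add_pow]
  rw [sum_eq_sup]
  refine Finset.sup_le fun m hm => mul_le_left.trans ?_
  rw [Finset.mem_range] at hm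
  by_cases hmq : q ≤ m
  · obtain ⟨l, rfl⟩ := Nat.exists_eq_add_of_le hmq
    have e1 : q + n = l + (q + q + n - (q + l)) := by omega
    rw [pow_add, mul_assoc]
    conv_rhs => rw [e1, pow_add]
    exact mul_mono hyq (mul_mono (pow_right_mono hy _) (pow_right_mono hz _))
  · have e1 : q + q + n - m = q + (q + n - m) := by omega
    have e2 : q + n = m + (q + n - m) := by omega
    rw [e1, pow_add, mul_left_comm]
    conv_rhs => rw [e2, pow_add]
    exact mul_mono hzq (mul_mono (pow_right_mono hy _) (pow_right_mono hz _))

lemma span_pair_pow_mul_le {R : Type*} [CommRing R] (y z : R) (q k : ℕ) :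
    span {y, z} ^ (q * (k + 1)) ≤ span {y ^ q, z ^ q} ^ k * span {y, z} ^ q := by
  induction k with
  | zero => simp
  | succ k ih =>
    rw [show q * (k + 1 + 1) = q + q + q * k by ring, pow_succ', mul_assoc]
    refine (span_pair_pow_le_mul y z q _).trans (mul_mono_right ?_)
    rwa [show q + q * k = q * (k + 1) by ring]

section Reduction

variable {R : Type*} [CommRing R] {x : R} {I : Ideal R} {N : ℕ}

lemma span_singleton_sup_pow_le (x : R) (I : Ideal R) (n : ℕ) :
    (span {x} ⊔ I) ^ (n + 1) ≤ span {x ^ (n + 1)} ⊔ I * (span {x} ⊔ I) ^ n := by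
  induction n with
  | zero => simp
  | succ n ih =>
    rw [pow_succ']
    conv_lhs => rw [sup_mul]
    refine sup_le ?_ le_sup_right
    refine (mul_mono_right ih).trans ?_
    rw [mul_sup, span_singleton_mul_span_singleton, ← pow_succ', mul_left_comm]
    refine sup_le_sup_left (mul_mono_right ?_) _
    rw [pow_succ']
    exact mul_mono_left le_sup_left

lemma span_singleton_sup_pow_eq (hN : N ≠ 0) (hx : x ^ N ∈ I ^ N) {n : ℕ} (hn : N ≤ n) :
    (span {x} ⊔ I) ^ n = I * (span {x} ⊔ I) ^ (n - 1) := by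
  have h : (span {x} ⊔ I) ^ N ≤ I * (span {x} ⊔ I) ^ (N - 1) := by
    obtain ⟨M, rfl⟩ := Nat.exists_eq_succ_of_ne_zero hN
    refine (span_singleton_sup_pow_le x I M).trans (sup_le ?_ le_rfl)
    rw [span_singleton_le_iff_mem]
    refine (?_ : I ^ (M + 1) ≤ _) hx
    rw [pow_succ']
    exact mul_mono_right (pow_right_mono le_sup_right _)
  refine le_antisymm ?_ ?_
  · obtain ⟨l, rfl⟩ := Nat.exists_eq_add_of_le hn
    rw [pow_add]
    refine (mul_mono_left h).trans ?_
    rw [mul_assoc, ← pow_add, show N - 1 + l = N + l - 1 by omega]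
  · conv_rhs => rw [show n = n - 1 + 1 by omega, pow_succ']
    exact mul_mono_left le_sup_right

lemma span_singleton_sup_pow_le_pow (hN : N ≠ 0) (hx : x ^ N ∈ I ^ N) (n : ℕ) :
    (span {x} ⊔ I) ^ (N - 1 + n) ≤ I ^ n := by
  induction n with
  | zero => simp
  | succ n ih =>
    rw [span_singleton_sup_pow_eq hN hx (by omega), pow_succ',
      show N - 1 + (n + 1) - 1 = N - 1 + n by omega]
    exact mul_mono_right ih

end Reduction

section TightClosure

lemma le_tightClosure {R : Type*} [CommRing R] (p : ℕ) (I : Ideal R) : I ≤ I.tightClosure p := by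
  refine fun x hx => subset_span ⟨1, fun P hP h => ?_, 0, fun e _ => ?_⟩
  · exact hP.1.1.ne_top ((eq_top_iff_one P).mpr h)
  · rw [one_mul]
    exact subset_span ⟨x, hx, rfl⟩

variable {R : Type*} [CommRing R] {p : ℕ} [Fact p.Prime] [CharP R p]

lemma mul_tightClosure_le (I J : Ideal R) :
    I * J.tightClosure p ≤ (I * J).tightClosure p := by
  rw [tightClosure, ← span_eq I, span_mul_span', span_eq, span_le]
  rintro _ ⟨r, hr, w, ⟨c, hc, e₀, H⟩, rfl⟩
  refine subset_span ⟨c, hc, e₀, fun e he => ?_⟩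
  have := H e he
  rw [frobeniusPower_prime_pow] at this ⊢
  rw [Ideal.map_mul, mul_pow, mul_left_comm]
  exact mul_mem_mul (mem_map_of_mem (iterateFrobenius R p e) hr) this

lemma span_triple_pow_le_tightClosure {x y z : R} {N : ℕ} (hN : N ≠ 0)
    (hx : x ^ N ∈ span {y, z} ^ N) (hy : y ∈ nonZeroDivisors R) (k : ℕ) :
    span {x, y, z} ^ (k + 1) ≤ (span {y, z} ^ k).tightClosure p := by
  intro w hw
  refine subset_span ⟨y ^ (N - 1), fun P hP =>
    fun h => notMem_nonZeroDivisors_of_mem_mem_minimalPrimes h hP (pow_mem hy _), N,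
    fun e he => ?_⟩
  rw [frobeniusPower_span_pair_pow]
  have hq : e < p ^ e := Nat.lt_pow_self (Fact.out : p.Prime).one_lt
  generalize p ^ e = q at hq
  refine ((span_pair_pow_mul_le y z q k).trans mul_le_left :) ?_
  have hw' : w ^ q ∈ (span {x} ⊔ span {y, z}) ^ (N - 1 + (q * (k + 1) - (N - 1))) := by
    rw [show N - 1 + (q * (k + 1) - (N - 1)) = (k + 1) * q by
      have : q ≤ q * (k + 1) := Nat.le_mul_of_pos_right _ (by omega)
      rw [mul_comm (k + 1)]
      omega, pow_mul, ← span_insert]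
    exact pow_mem_pow hw q
  have h1 := span_singleton_sup_pow_le_pow hN hx _ hw'
  rw [show q * (k + 1) = N - 1 + (q * (k + 1) - (N - 1)) by
      have : q ≤ q * (k + 1) := Nat.le_mul_of_pos_right _ (by omega)
      omega, pow_add]
  exact mul_mem_mul (pow_mem_pow (subset_span (by simp)) _) h1

end TightClosure

end Ideal

namespace MvPowerSeries
variable {F : Type*} [Field F]

/-- The quotient of `g` by `X₀ ^ N + X₁ ^ N + X₂ ^ N` with respect to the variable `X₀`. -/
noncomputable def fermatQuotient (N : ℕ) (g : MvPowerSeries (Fin 3) F) : MvPowerSeries (Fin 3) F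
  | d => coeff (d + Finsupp.single 0 N) g
    - (if 0 < N ∧ Finsupp.single 1 N ≤ d + Finsupp.single 0 N then
        fermatQuotient N g (d + Finsupp.single 0 N - Finsupp.single 1 N) else 0)
    - (if 0 < N ∧ Finsupp.single 2 N ≤ d + Finsupp.single 0 N then
        fermatQuotient N g (d + Finsupp.single 0 N - Finsupp.single 2 N) else 0)
  termination_by d => d 1 + d 2
  decreasing_by
    · rename_i h
      have := h.2 1
      simp at this ⊢
      exact ⟨h.1.trans_le this, h.1⟩
    · rename_i h
      have := h.2 2
      simp at this ⊢
      exact ⟨h.1.trans_le this, h.1⟩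

lemma coeff_fermat_mul (N : ℕ) (h : MvPowerSeries (Fin 3) F) (d : Fin 3 →₀ ℕ) :
    coeff (d + Finsupp.single 0 N) ((X 0 ^ N + X 1 ^ N + X 2 ^ N) * h) = coeff d h
      + (if Finsupp.single 1 N ≤ d + Finsupp.single 0 N then
          coeff (d + Finsupp.single 0 N - Finsupp.single 1 N) h else 0)
      + (if Finsupp.single 2 N ≤ d + Finsupp.single 0 N then
          coeff (d + Finsupp.single 0 N - Finsupp.single 2 N) h else 0) := by
  simp only [add_mul, map_add, X_pow_eq, coeff_monomial_mul, one_mul]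
  rw [if_pos (by simp), add_tsub_cancel_right]

lemma coeff_sub_fermat_mul_fermatQuotient {N : ℕ} (hN : 0 < N) (g : MvPowerSeries (Fin 3) F)
    {d : Fin 3 →₀ ℕ} (hd : N ≤ d 0) :
    coeff d (g - (X 0 ^ N + X 1 ^ N + X 2 ^ N) * fermatQuotient N g) = 0 := by
  obtain ⟨d, rfl⟩ : ∃ d', d = d' + Finsupp.single 0 N :=
    ⟨d - Finsupp.single 0 N, (tsub_add_cancel_of_le (by simpa using hd)).symm⟩
  rw [map_sub, coeff_fermat_mul]
  have h : coeff d (fermatQuotient N g) = fermatQuotient N g d := rfl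
  rw [h, fermatQuotient]
  simp only [hN, true_and]
  change coeff (d + Finsupp.single 0 N) g - (coeff (d + Finsupp.single 0 N) g
    - (if Finsupp.single 1 N ≤ d + Finsupp.single 0 N then
          coeff (d + Finsupp.single 0 N - Finsupp.single 1 N) (fermatQuotient N g) else 0)
    - (if Finsupp.single 2 N ≤ d + Finsupp.single 0 N then
          coeff (d + Finsupp.single 0 N - Finsupp.single 2 N) (fermatQuotient N g) else 0) +
    _ + _) = 0
  ring

lemma eq_zero_of_coeff_fermat_mul_eq_zero {N : ℕ} (hN : 0 < N) {h : MvPowerSeries (Fin 3) F}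
    (hh : ∀ d : Fin 3 →₀ ℕ, N ≤ d 0 → coeff d ((X 0 ^ N + X 1 ^ N + X 2 ^ N) * h) = 0) :
    h = 0 := by
  ext d
  rw [coeff_zero]
  induction hs : d 1 + d 2 using Nat.strong_induction_on generalizing d with
  | _ s ih =>
    have := hh (d + Finsupp.single 0 N) (by simp)
    rw [coeff_fermat_mul] at this
    have h1 : (if Finsupp.single 1 N ≤ d + Finsupp.single 0 N then
          coeff (d + Finsupp.single 0 N - Finsupp.single 1 N) h else 0) = 0 := by
      split_ifs with hle
      · have := hle 1
        refine ih _ ?_ _ rfl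
        simp at this ⊢
        omega
      · rfl
    have h2 : (if Finsupp.single 2 N ≤ d + Finsupp.single 0 N then
          coeff (d + Finsupp.single 0 N - Finsupp.single 2 N) h else 0) = 0 := by
      split_ifs with hle
      · have := hle 2
        refine ih _ ?_ _ rfl
        simp at this ⊢
        omega
      · rfl
    rwa [h1, h2, add_zero, add_zero] at this

variable (F) in
/-- The inclusion `F⟦Y, Z⟧ → F⟦X, Y, Z⟧`. -/
noncomputable def succHom : MvPowerSeries (Fin 2) F →ₐ[F] MvPowerSeries (Fin 3) F :=
  rename (Fin.succEmb 2)

lemma coeff_succHom (a : MvPowerSeries (Fin 2) F) (d : Fin 3 →₀ ℕ) :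
    coeff d (succHom F a) = if d 0 = 0 then coeff d.tail a else 0 := by
  split_ifs with h
  · have : d = Finsupp.embDomain (Fin.succEmb 2) d.tail := by
      ext i
      refine Fin.cases ?_ (fun j => ?_) i
      · rw [h, Finsupp.embDomain_of_notMem_range]
        simp
      · exact (Finsupp.embDomain_apply_self (Fin.succEmb 2) d.tail j).symm
    conv_lhs => rw [this]
    exact coeff_embDomain_rename _ _ _
  · refine coeff_rename_eq_zero _ _ ?_
    rintro ⟨d', rfl⟩
    refine h ?_
    rw [← Finsupp.embDomain_eq_mapDomain, Finsupp.embDomain_of_notMem_range]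
    simp

lemma coeff_sum_X_pow_mul_succHom {N : ℕ} (a : Fin N → MvPowerSeries (Fin 2) F)
    (d : Fin 3 →₀ ℕ) : coeff d (∑ i : Fin N, X 0 ^ (i : ℕ) * succHom F (a i)) =
      if h : d 0 < N then coeff d.tail (a ⟨d 0, h⟩) else 0 := by
  have key (i : Fin N) : coeff d (X 0 ^ (i : ℕ) * succHom F (a i)) =
      if (i : ℕ) = d 0 then coeff d.tail (a i) else 0 := by
    rw [X_pow_eq, coeff_monomial_mul, one_mul, coeff_succHom]
    have ht : (d - Finsupp.single 0 (i : ℕ)).tail = d.tail := by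
      ext j
      simp [Finsupp.tail_apply]
    rw [ht]
    by_cases h : (i : ℕ) = d 0
    · simp [h]
    · by_cases h' : (i : ℕ) ≤ d 0
      · have : d 0 - (i : ℕ) ≠ 0 := by omega
        simp [h, this]
      · simp [h, h']
  rw [map_sum, Finset.sum_congr rfl fun i _ => key i]
  split_ifs with h
  · rw [Finset.sum_eq_single ⟨d 0, h⟩ _ (by simp)]
    · simp
    · intro i _ hi
      rw [if_neg fun h' => hi (Fin.ext h')]
  · refine Finset.sum_eq_zero fun i _ => if_neg ?_
    have := i.2
    omega

lemma exists_basis_fermat {N : ℕ} (hN : 0 < N)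
    {Q : Ideal (MvPowerSeries (Fin 3) F)} (hQ : Q = Ideal.span {X 0 ^ N + X 1 ^ N + X 2 ^ N})
    [Algebra (MvPowerSeries (Fin 2) F) (MvPowerSeries (Fin 3) F ⧸ Q)]
    (halg : ∀ a, algebraMap (MvPowerSeries (Fin 2) F) (MvPowerSeries (Fin 3) F ⧸ Q) a =
      Ideal.Quotient.mk Q (succHom F a)) :
    ∃ b : Module.Basis (Fin N) (MvPowerSeries (Fin 2) F) (MvPowerSeries (Fin 3) F ⧸ Q),
      ∀ i, b i = Ideal.Quotient.mk Q (X 0) ^ (i : ℕ) := by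
  have hsum (a : Fin N → MvPowerSeries (Fin 2) F) :
      ∑ i, a i • Ideal.Quotient.mk Q (X 0) ^ (i : ℕ) =
        Ideal.Quotient.mk Q (∑ i : Fin N, X 0 ^ (i : ℕ) * succHom F (a i)) := by
    simp only [map_sum, map_mul, map_pow, Algebra.smul_def, halg]
    exact Finset.sum_congr rfl fun i _ => mul_comm _ _
  refine ⟨Module.Basis.mk (v := fun i : Fin N => Ideal.Quotient.mk Q (X 0) ^ (i : ℕ)) ?_ ?_,
    fun i => by rw [Module.Basis.mk_apply]⟩
  · rw [Fintype.linearIndependent_iff]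
    intro a ha i
    rw [hsum, Ideal.Quotient.eq_zero_iff_mem, hQ, Ideal.mem_span_singleton] at ha
    obtain ⟨h, hh⟩ := ha
    have h0 : h = 0 := by
      refine eq_zero_of_coeff_fermat_mul_eq_zero hN fun d hd => ?_
      rw [← hh, coeff_sum_X_pow_mul_succHom, dif_neg (by omega)]
    ext d
    have := coeff_sum_X_pow_mul_succHom a (d.cons i)
    rw [hh, h0, mul_zero, coeff_zero] at this
    simpa using this.symm
  · rintro r -
    obtain ⟨g, rfl⟩ := Ideal.Quotient.mk_surjective r
    let a : Fin N → MvPowerSeries (Fin 2) F := fun i d =>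
      coeff (d.cons i) (g - (X 0 ^ N + X 1 ^ N + X 2 ^ N) * fermatQuotient N g)
    have : Ideal.Quotient.mk Q g = ∑ i, a i • Ideal.Quotient.mk Q (X 0) ^ (i : ℕ) := by
      rw [hsum, Ideal.Quotient.eq, hQ, Ideal.mem_span_singleton]
      refine ⟨fermatQuotient N g, ?_⟩
      rw [sub_eq_iff_eq_add, add_comm, ← sub_eq_iff_eq_add]
      ext d
      rw [coeff_sum_X_pow_mul_succHom]
      split_ifs with h
      · change _ = coeff (d.tail.cons (d 0))
          (g - (X 0 ^ N + X 1 ^ N + X 2 ^ N) * fermatQuotient N g)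
        rw [Finsupp.cons_tail]
      · exact coeff_sub_fermat_mul_fermatQuotient hN g (by omega)
    rw [this]
    exact sum_mem fun i _ => Submodule.smul_mem _ _ (Submodule.subset_span ⟨i, rfl⟩)

end MvPowerSeries

/-- The upper bound for the tight closure of `(y, z) ^ k` in an extension of `F⟦Y, Z⟧` that is
free on the powers `1, x, …, x ^ (N - 1)`, where `x ^ N + y ^ N + z ^ N = 0`. -/
lemma Ideal.tightClosure_span_pair_pow_le {F : Type*} [Field F] {p : ℕ} [Fact p.Prime] [CharP F p]
    {N : ℕ} (hpN : ¬ p ∣ N) {R : Type*} [CommRing R] [CharP R p]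
    [Algebra (MvPowerSeries (Fin 2) F) R] {x y z : R}
    (hy : algebraMap (MvPowerSeries (Fin 2) F) R (X 0) = y)
    (hz : algebraMap (MvPowerSeries (Fin 2) F) R (X 1) = z)
    (hx : x ^ N = -(y ^ N + z ^ N)) (b : Module.Basis (Fin N) (MvPowerSeries (Fin 2) F) R)
    (hb : ∀ i, b i = x ^ (i : ℕ)) (k : ℕ) :
    (span {y, z} ^ k).tightClosure p ≤ span {x, y, z} ^ (k + 1) ⊔ span {y, z} ^ k := by
  have hI (k : ℕ) : span {y, z} ^ k =
      (span {X 0, X 1} ^ k).map (algebraMap (MvPowerSeries (Fin 2) F) R) := by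
    rw [map_span_pair_pow, hy, hz]
  have hfin : Module.Finite (MvPowerSeries (Fin 2) F) R := Module.Finite.of_basis b
  rw [tightClosure, span_le]
  rintro w ⟨c', hc', e₀, H⟩
  have : IsDomain (MvPowerSeries (Fin 2) F) := NoZeroDivisors.to_isDomain _
  obtain ⟨c, hc, hcc⟩ := exists_ne_zero_dvd_algebraMap (A := MvPowerSeries (Fin 2) F) hc'
  set a := b.repr w with ha
  have hw : w = ∑ i, algebraMap _ R (a i) * x ^ (i : ℕ) := by
    conv_lhs => rw [← b.sum_repr w]
    simp [Algebra.smul_def, hb, ha]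
  have hp := (Fact.out : p.Prime)
  have hcop (e : ℕ) : (p ^ e).Coprime N :=
    Nat.Coprime.pow_left _ ((Nat.Prime.coprime_iff_not_dvd hp).mpr hpN)
  have key (i : Fin N) : a i ∈ span {X 0, X 1} ^ (if (i : ℕ) = 0 then k else k + 1 - i) := by
    refine mem_span_X_pow_of_forall_mul_fermat_pow_mem hpN i.2 hc (e₀ := e₀) fun e he => ?_
    have hN : 0 < N := i.pos
    have h1 : algebraMap _ R c * w ^ p ^ e ∈
        (span {X 0 ^ p ^ e, X 1 ^ p ^ e} ^ k).map (algebraMap (MvPowerSeries (Fin 2) F) R) := by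
      rw [map_span_pair_pow, map_pow, map_pow, hy, hz, ← frobeniusPower_span_pair_pow]
      obtain ⟨r, hr⟩ := hcc
      rw [hr, mul_right_comm]
      exact mul_mem_right _ _ (H e he)
    let σ : Fin N → Fin N := fun i => ⟨i * p ^ e % N, Nat.mod_lt _ hN⟩
    have hσ : Function.Injective σ := by
      intro i j hij
      have : (i : ℕ) * p ^ e ≡ j * p ^ e [MOD N] := congrArg Fin.val hij
      have := Nat.ModEq.cancel_right_of_coprime (hcop e).symm this
      rw [Nat.ModEq, Nat.mod_eq_of_lt i.2, Nat.mod_eq_of_lt j.2] at this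
      exact Fin.ext this
    have hterm (i : Fin N) : (algebraMap _ R (a i) * x ^ (i : ℕ)) ^ p ^ e =
        algebraMap _ R ((-(X 0 ^ N + X 1 ^ N)) ^ (i * p ^ e / N) * a i ^ p ^ e) * b (σ i) := by
      have : x ^ ((i : ℕ) * p ^ e) = (x ^ N) ^ (i * p ^ e / N) * x ^ (i * p ^ e % N) := by
        rw [← pow_mul, ← pow_add, Nat.div_add_mod]
      rw [mul_pow, ← pow_mul, this, hx, hb, map_mul, map_pow, map_pow, map_neg, map_add, map_pow,
        map_pow, hy, hz]
      ring
    have hrepr : b.repr (algebraMap _ R c * w ^ p ^ e) (σ i) =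
        c * ((-(X 0 ^ N + X 1 ^ N)) ^ (i * p ^ e / N) * a i ^ p ^ e) := by
      rw [hw, sum_pow_char_pow, Finset.sum_congr rfl fun i _ => hterm i]
      simp only [← Algebra.smul_def, map_smul, map_sum, Finsupp.smul_apply, smul_eq_mul,
        Finsupp.coe_finsetSum, Finset.sum_apply, Module.Basis.repr_self]
      rw [Finset.sum_eq_single i _ (by simp)]
      · simp
      · intro j _ hj
        rw [Finsupp.single_eq_of_ne fun h => hj (hσ h.symm), mul_zero]
    have h2 := b.repr_mem_of_mem_map h1 (σ i)
    rw [hrepr, neg_pow, mul_assoc, mul_left_comm] at h2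
    have h3 := mul_mem_left _ ((-1) ^ ((i : ℕ) * p ^ e / N)) h2
    rw [← mul_assoc, ← mul_pow, neg_one_mul, neg_neg, one_pow, one_mul, ← mul_assoc] at h3
    exact h3
  have hIm : span {y, z} ≤ span {x, y, z} := span_mono (by simp)
  rw [hw]
  refine _root_.sum_mem fun i _ => ?_
  have h1 := mem_map_of_mem (algebraMap _ R) (key i)
  rw [← hI] at h1
  split_ifs at h1 with hi
  · rw [hi, pow_zero, mul_one]
    exact mem_sup_right h1
  · refine mem_sup_left ?_
    have h2 := mul_mem_mul (pow_right_mono hIm _ h1)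
      (pow_mem_pow (subset_span (by simp) : x ∈ span {x, y, z}) (i : ℕ))
    rw [← pow_add] at h2
    exact pow_le_pow_right (by omega) h2

/-- The tight reduction number of `(y, z)` in an extension of `F⟦Y, Z⟧` that is free on the powers
`1, x, …, x ^ (N - 1)`, where `x ^ N + y ^ N + z ^ N = 0`. -/
lemma Ideal.tightClosure_span_pair_pow_eq_mul {F : Type*} [Field F] {p : ℕ} [Fact p.Prime]
    [CharP F p] {N : ℕ} (hN : 3 ≤ N) (hpN : ¬ p ∣ N) {R : Type*} [CommRing R] [CharP R p]
    [Algebra (MvPowerSeries (Fin 2) F) R] {x y z : R}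
    (hy : algebraMap (MvPowerSeries (Fin 2) F) R (X 0) = y)
    (hz : algebraMap (MvPowerSeries (Fin 2) F) R (X 1) = z)
    (hx : x ^ N = -(y ^ N + z ^ N)) (b : Module.Basis (Fin N) (MvPowerSeries (Fin 2) F) R)
    (hb : ∀ i, b i = x ^ (i : ℕ)) :
    (∀ k : ℕ, N - 1 ≤ k → (Ideal.span {y, z} ^ k).tightClosure p =
        Ideal.span {y, z} * (Ideal.span {y, z} ^ (k - 1)).tightClosure p) ∧
      (Ideal.span {y, z} ^ (N - 2)).tightClosure p ≠
        Ideal.span {y, z} * (Ideal.span {y, z} ^ (N - 3)).tightClosure p := by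
  have hxN : x ^ N ∈ Ideal.span {y, z} ^ N := by
    rw [hx]
    exact neg_mem (add_mem (Ideal.pow_mem_pow (Ideal.subset_span (by simp)) _)
      (Ideal.pow_mem_pow (Ideal.subset_span (by simp)) _))
  have hm : Ideal.span {x, y, z} = Ideal.span {x} ⊔ Ideal.span {y, z} := Ideal.span_insert _ _
  have hy0 : y ∈ nonZeroDivisors R := by
    rw [← hy]
    exact b.algebraMap_mem_nonZeroDivisors (X_mem_nonzeroDivisors (i := 0))
  have hle (k : ℕ) : Ideal.span {x, y, z} ^ (k + 1) ≤ (Ideal.span {y, z} ^ k).tightClosure p :=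
    Ideal.span_triple_pow_le_tightClosure (by omega) hxN hy0 k
  refine ⟨fun k hk => le_antisymm ?_ ?_, fun h => ?_⟩
  · refine (Ideal.tightClosure_span_pair_pow_le hpN hy hz hx b hb k).trans (sup_le ?_ ?_)
    · rw [hm, Ideal.span_singleton_sup_pow_eq (by omega) hxN (by omega), ← hm]
      have := hle (k - 1)
      rw [show k - 1 + 1 = k by omega] at this
      exact Ideal.mul_mono_right this
    · rw [show k = k - 1 + 1 by omega, pow_succ']
      exact Ideal.mul_mono_right (Ideal.le_tightClosure p _)
  · refine (Ideal.mul_tightClosure_le _ _).trans_eq ?_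
    rw [← pow_succ', show k - 1 + 1 = k by omega]
  · have h1 : x ^ (N - 1) ∈ (Ideal.span {y, z} ^ (N - 2)).tightClosure p := by
      refine hle _ ?_
      rw [show N - 2 + 1 = N - 1 by omega]
      exact Ideal.pow_mem_pow (Ideal.subset_span (by simp)) _
    rw [h] at h1
    have h2 : x ^ (N - 1) ∈ Ideal.map (algebraMap (MvPowerSeries (Fin 2) F) R)
        (Ideal.span {X 0, X 1} ^ 1) := by
      rw [Ideal.map_span_pair_pow, hy, hz, pow_one]
      exact Ideal.mul_le_left h1
    have h3 := b.repr_mem_of_mem_map h2 ⟨N - 1, by omega⟩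
    rw [← hb ⟨N - 1, by omega⟩, b.repr_self, Finsupp.single_eq_same, pow_one] at h3
    have h4 : Ideal.span {X 0, X 1} ≤
        RingHom.ker (constantCoeff : MvPowerSeries (Fin 2) F →+* F) := by
      rw [Ideal.span_le]
      rintro _ (rfl | rfl) <;> simp
    simpa using h4 h3

/-- **The tight reduction number of `I = (y,z)` is `N - 2`.** Let
`R = F[[X,Y,Z]]/(X^N + Y^N + Z^N)` with `N ≥ 3`, `F` an infinite field of prime
characteristic `p`, `p ∤ N`, and let `I = (y, z)`, `m = (x, y, z)`. Then
`(I^k)^* = I (I^{k-1})^*` for all `k ≥ N - 1`, but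
`(I^{N-2})^* ≠ I (I^{N-3})^*`. -/
theorem diagonal_tight_reduction_number (F : Type*) [Field F] [Infinite F]
    (p : ℕ) [Fact p.Prime] [CharP F p] (N : ℕ) (hN : 3 ≤ N) (hpN : ¬ p ∣ N)
    (Q : Ideal (MvPowerSeries (Fin 3) F))
    (hQ : Q = Ideal.span {(X 0 : MvPowerSeries (Fin 3) F) ^ N + X 1 ^ N + X 2 ^ N})
    (I m : Ideal (MvPowerSeries (Fin 3) F ⧸ Q))
    (hI : I = Ideal.span {Ideal.Quotient.mk Q (X 1), Ideal.Quotient.mk Q (X 2)})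
    (hm : m = Ideal.span {Ideal.Quotient.mk Q (X 0), Ideal.Quotient.mk Q (X 1),
      Ideal.Quotient.mk Q (X 2)}) :
    (∀ k : ℕ, N - 1 ≤ k → Ideal.tightClosure p (I ^ k) =
        I * Ideal.tightClosure p (I ^ (k - 1))) ∧
      Ideal.tightClosure p (I ^ (N - 2)) ≠ I * Ideal.tightClosure p (I ^ (N - 3)) := by
  subst hQ hI hm
  set Q : Ideal (MvPowerSeries (Fin 3) F) :=
    Ideal.span {(X 0 : MvPowerSeries (Fin 3) F) ^ N + X 1 ^ N + X 2 ^ N} with hQ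
  set x := Ideal.Quotient.mk Q (X 0)
  set y := Ideal.Quotient.mk Q (X 1)
  set z := Ideal.Quotient.mk Q (X 2)
  let _ : Algebra (MvPowerSeries (Fin 2) F) (MvPowerSeries (Fin 3) F ⧸ Q) :=
    ((Ideal.Quotient.mk Q).comp (succHom F).toRingHom).toAlgebra
  have halg (a : MvPowerSeries (Fin 2) F) :
      algebraMap (MvPowerSeries (Fin 2) F) (MvPowerSeries (Fin 3) F ⧸ Q) a =
        Ideal.Quotient.mk Q (succHom F a) := rfl
  obtain ⟨b, hb⟩ := exists_basis_fermat (by omega) hQ halg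
  have hy : algebraMap (MvPowerSeries (Fin 2) F) (MvPowerSeries (Fin 3) F ⧸ Q) (X 0) = y := by
    rw [halg, succHom, rename_X]
    rfl
  have hz : algebraMap (MvPowerSeries (Fin 2) F) (MvPowerSeries (Fin 3) F ⧸ Q) (X 1) = z := by
    rw [halg, succHom, rename_X]
    rfl
  have hx : x ^ N = -(y ^ N + z ^ N) := by
    rw [eq_neg_iff_add_eq_zero, ← add_assoc, ← map_pow, ← map_pow, ← map_pow, ← map_add, ← map_add,
      Ideal.Quotient.eq_zero_iff_mem]
    exact Ideal.subset_span rfl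
  have : Nonempty (Fin N) := ⟨⟨0, by omega⟩⟩
  have : Nontrivial (MvPowerSeries (Fin 3) F ⧸ Q) := b.repr.toEquiv.nontrivial
  have : CharP (MvPowerSeries (Fin 3) F ⧸ Q) p :=
    charP_of_injective_algebraMap (algebraMap F (MvPowerSeries (Fin 3) F ⧸ Q)).injective p
  exact Ideal.tightClosure_span_pair_pow_eq_mul hN hpN hy hz hx b hb
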